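/- The Hopf differential coefficient of a conformal minimal immersion f : ℂ → S^n is holomorphic: the function z ↦ ⟨Ω(z), Ω(z)⟩ satisfies ∂_{z̄} ⟨Ω, Ω⟩ = 0 on all of ℂ. -/

import Mathlib

open Complex

noncomputable section

/-- Wirtinger derivative `∂_z` of a map `ℂ → ℂ`. -/
def wirtZ (g : ℂ → ℂ) (z : ℂ) : ℂ :=
  (1 / 2 : ℂ) * (fderiv ℝ g z 1 - Complex.I * fderiv ℝ g z Complex.I)

/-- Wirtinger derivative `∂_z̄` of a map `ℂ → ℂ`. -/
def wirtZbar (g : ℂ → ℂ) (z : ℂ) : ℂ :=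
  (1 / 2 : ℂ) * (fderiv ℝ g z 1 + Complex.I * fderiv ℝ g z Complex.I)

/-- Componentwise `∂_z` for vector-valued maps. -/
def WZ {m : ℕ} (g : ℂ → Fin m → ℂ) : ℂ → Fin m → ℂ :=
  fun z i => wirtZ (fun w => g w i) z

/-- Componentwise `∂_z̄` for vector-valued maps. -/
def WZb {m : ℕ} (g : ℂ → Fin m → ℂ) : ℂ → Fin m → ℂ :=
  fun z i => wirtZbar (fun w => g w i) z

/-- Complex-bilinear (non-conjugating) pairing. -/
def pairC {m : ℕ} (u v : Fin m → ℂ) : ℂ := ∑ i, u i * v i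

/-- Componentwise complex conjugation. -/
def conjV {m : ℕ} (u : Fin m → ℂ) : Fin m → ℂ := fun i => (starRingEnd ℂ) (u i)

/-- Complexification of a real vector. -/
def cV {m : ℕ} (u : Fin m → ℝ) : Fin m → ℂ := fun i => (u i : ℂ)

/-- Complexification of a real-vector-valued map. -/
def Fc {m : ℕ} (f : ℂ → Fin m → ℝ) : ℂ → Fin m → ℂ := fun z => cV (f z)

/-- `∂_z` of (the complexification of) a real-valued function. -/
def dZ (ρ : ℂ → ℝ) (z : ℂ) : ℂ := wirtZ (fun w => ((ρ w : ℝ) : ℂ)) z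

/-- `f : ℂ → S^n ⊂ ℝ^{n+1}` is a conformal minimal immersion with conformal factor `ρ`:
`⟨f_z, f_z⟩ = 0`, `⟨f_z, f̄_z⟩ = (1/2) e^{2ρ}`, and `f_{z z̄} = −(1/2) e^{2ρ} f`. -/
def IsConfMinImm {m : ℕ} (f : ℂ → Fin m → ℝ) (ρ : ℂ → ℝ) : Prop :=
  ContDiff ℝ (⊤ : ℕ∞) f ∧ ContDiff ℝ (⊤ : ℕ∞) ρ ∧
  (∀ z, ∑ i, (f z i) ^ 2 = 1) ∧
  (∀ z, pairC (WZ (Fc f) z) (WZ (Fc f) z) = 0) ∧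
  (∀ z, pairC (WZ (Fc f) z) (conjV (WZ (Fc f) z)) = (1 / 2 : ℂ) * (Real.exp (2 * ρ z) : ℂ)) ∧
  (∀ z i, WZb (WZ (Fc f)) z i = -(1 / 2 : ℂ) * (Real.exp (2 * ρ z) : ℂ) * Fc f z i)

/-- The Hopf field `Ω = f_{zz} − 2 ρ_z f_z`. -/
def Hopf {m : ℕ} (f : ℂ → Fin m → ℝ) (ρ : ℂ → ℝ) : ℂ → Fin m → ℂ :=
  fun z i => WZ (WZ (Fc f)) z i - 2 * dZ ρ z * WZ (Fc f) z i

/-- Real part `Ω₁` of the Hopf field, viewed in `ℂ^{n+1}`. -/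
def HopfRe {m : ℕ} (f : ℂ → Fin m → ℝ) (ρ : ℂ → ℝ) : ℂ → Fin m → ℂ :=
  fun z i => ((Hopf f ρ z i).re : ℂ)

/-- Imaginary part `Ω₂` of the Hopf field, viewed in `ℂ^{n+1}`. -/
def HopfIm {m : ℕ} (f : ℂ → Fin m → ℝ) (ρ : ℂ → ℝ) : ℂ → Fin m → ℂ :=
  fun z i => ((Hopf f ρ z i).im : ℂ)

/-- Normal projection `E^⊥` of a constant vector `E ∈ ℝ^{n+1}`. -/
def Eperp {m : ℕ} (f : ℂ → Fin m → ℝ) (ρ : ℂ → ℝ) (E : Fin m → ℝ) : ℂ → Fin m → ℂ :=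
  fun z i => (E i : ℂ) - pairC (cV E) (Fc f z) * Fc f z i
    - 2 * (Real.exp (-2 * ρ z) : ℂ) * pairC (cV E) (WZ (Fc f) z) * WZb (Fc f) z i
    - 2 * (Real.exp (-2 * ρ z) : ℂ) * pairC (cV E) (WZb (Fc f) z) * WZ (Fc f) z i

/-- `ψ` is a normal field along `f`. -/
def IsNormalField {m : ℕ} (f : ℂ → Fin m → ℝ) (ψ : ℂ → Fin m → ℂ) : Prop :=
  ∀ z, pairC (ψ z) (Fc f z) = 0 ∧ pairC (ψ z) (WZ (Fc f) z) = 0 ∧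
    pairC (ψ z) (WZb (Fc f) z) = 0

/-- Normal covariant derivative `N_z ψ = ψ_z + 2 e^{−2ρ} ⟨ψ, Ω⟩ f_z̄`. -/
def NZ {m : ℕ} (f : ℂ → Fin m → ℝ) (ρ : ℂ → ℝ) (ψ : ℂ → Fin m → ℂ) : ℂ → Fin m → ℂ :=
  fun z i => WZ ψ z i
    + 2 * (Real.exp (-2 * ρ z) : ℂ) * pairC (ψ z) (Hopf f ρ z) * WZb (Fc f) z i

/-- Normal covariant derivative `N_z̄ ψ = ψ_z̄ + 2 e^{−2ρ} ⟨ψ, Ω̄⟩ f_z`. -/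
def NZb {m : ℕ} (f : ℂ → Fin m → ℝ) (ρ : ℂ → ℝ) (ψ : ℂ → Fin m → ℂ) : ℂ → Fin m → ℂ :=
  fun z i => WZb ψ z i
    + 2 * (Real.exp (-2 * ρ z) : ℂ) * pairC (ψ z) (conjV (Hopf f ρ z)) * WZ (Fc f) z i

/-- Normal Laplacian `Δ^⊥ ψ = 2 e^{−2ρ} (N_z̄ (N_z ψ) + N_z (N_z̄ ψ))`. -/
def LapPerp {m : ℕ} (f : ℂ → Fin m → ℝ) (ρ : ℂ → ℝ) (ψ : ℂ → Fin m → ℂ) : ℂ → Fin m → ℂ :=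
  fun z i => 2 * (Real.exp (-2 * ρ z) : ℂ) * (NZb f ρ (NZ f ρ ψ) z i + NZ f ρ (NZb f ρ ψ) z i)

/-- Jacobi operator `𝓛 ψ = Δ^⊥ ψ + 2 ψ + 4 e^{−4ρ} (⟨ψ, Ω⟩ Ω̄ + ⟨ψ, Ω̄⟩ Ω)`. -/
def Jacobi {m : ℕ} (f : ℂ → Fin m → ℝ) (ρ : ℂ → ℝ) (ψ : ℂ → Fin m → ℂ) : ℂ → Fin m → ℂ :=
  fun z i => LapPerp f ρ ψ z i + 2 * ψ z i
    + 4 * (Real.exp (-4 * ρ z) : ℂ) *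
      (pairC (ψ z) (Hopf f ρ z) * conjV (Hopf f ρ z) i
        + pairC (ψ z) (conjV (Hopf f ρ z)) * Hopf f ρ z i)

/-- The S⁴ adapted frame setup: `⟨Ω, Ω⟩ ≡ 1`, `Ω₁ = cosh θ · ψ₃`, `Ω₂ = sinh θ · ψ₄`
with `ψ₃, ψ₄` orthonormal normal fields. -/
def S4Frame (f : ℂ → Fin 5 → ℝ) (ρ : ℂ → ℝ) (ψ₃ ψ₄ : ℂ → Fin 5 → ℝ) (θ : ℂ → ℝ) : Prop :=
  ContDiff ℝ (⊤ : ℕ∞) ψ₃ ∧ ContDiff ℝ (⊤ : ℕ∞) ψ₄ ∧ ContDiff ℝ (⊤ : ℕ∞) θ ∧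
  IsNormalField f (Fc ψ₃) ∧ IsNormalField f (Fc ψ₄) ∧
  (∀ z, ∑ i, (ψ₃ z i) ^ 2 = 1) ∧ (∀ z, ∑ i, (ψ₄ z i) ^ 2 = 1) ∧
  (∀ z, ∑ i, ψ₃ z i * ψ₄ z i = 0) ∧
  (∀ z, pairC (Hopf f ρ z) (Hopf f ρ z) = 1) ∧
  (∀ z i, (Hopf f ρ z i).re = Real.cosh (θ z) * ψ₃ z i) ∧
  (∀ z i, (Hopf f ρ z i).im = Real.sinh (θ z) * ψ₄ z i)

open scoped ContDiff

lemma contDiff_wirtZ {g : ℂ → ℂ} (hg : ContDiff ℝ ∞ g) : ContDiff ℝ ∞ (wirtZ g) := by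
  have h : ContDiff ℝ ∞ (fderiv ℝ g) := hg.fderiv_right (by simp)
  exact contDiff_const.mul ((h.clm_apply contDiff_const).sub
    (contDiff_const.mul (h.clm_apply contDiff_const)))

lemma wirtZ_mul {a b : ℂ → ℂ} (ha : Differentiable ℝ a) (hb : Differentiable ℝ b) (z : ℂ) :
    wirtZ (fun w => a w * b w) z = wirtZ a z * b z + a z * wirtZ b z := by
  simp only [wirtZ, fderiv_fun_mul (ha z) (hb z), add_apply,
    smul_apply, smul_eq_mul]
  ring

lemma wirtZbar_mul {a b : ℂ → ℂ} (ha : Differentiable ℝ a) (hb : Differentiable ℝ b) (z : ℂ) :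
    wirtZbar (fun w => a w * b w) z = wirtZbar a z * b z + a z * wirtZbar b z := by
  simp only [wirtZbar, fderiv_fun_mul (ha z) (hb z), add_apply,
    smul_apply, smul_eq_mul]
  ring

lemma wirtZ_sum {ι : Type*} (s : Finset ι) {a : ι → ℂ → ℂ}
    (ha : ∀ i, Differentiable ℝ (a i)) (z : ℂ) :
    wirtZ (fun w => ∑ i ∈ s, a i w) z = ∑ i ∈ s, wirtZ (a i) z := by
  simp only [wirtZ, fderiv_fun_sum fun i _ => ha i z, sum_apply,
    Finset.mul_sum, Finset.sum_sub_distrib, mul_sub]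

lemma wirtZbar_sum {ι : Type*} (s : Finset ι) {a : ι → ℂ → ℂ}
    (ha : ∀ i, Differentiable ℝ (a i)) (z : ℂ) :
    wirtZbar (fun w => ∑ i ∈ s, a i w) z = ∑ i ∈ s, wirtZbar (a i) z := by
  simp only [wirtZbar, fderiv_fun_sum fun i _ => ha i z, sum_apply,
    Finset.mul_sum, Finset.sum_add_distrib, mul_add]

lemma wirtZ_const (c z : ℂ) : wirtZ (fun _ => c) z = 0 := by
  simp [wirtZ]

/-- The Wirtinger derivatives commute on smooth functions. -/
lemma wirtZbar_wirtZ_comm {g : ℂ → ℂ} (hg : ContDiff ℝ ∞ g) (z : ℂ) :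
    wirtZbar (wirtZ g) z = wirtZ (wirtZbar g) z := by
  have h : Differentiable ℝ (fderiv ℝ g) :=
    (hg.fderiv_right (m := ∞) (by simp)).differentiable (by simp)
  have hv (v : ℂ) : HasFDerivAt (fun w => fderiv ℝ g w v)
      ((fderiv ℝ (fderiv ℝ g) z).flip v) z := by
    simpa using (h z).hasFDerivAt.clm_apply (hasFDerivAt_const v z)
  have hZ : HasFDerivAt (wirtZ g) _ z :=
    ((hv 1).sub ((hv I).const_mul I)).const_mul (1 / 2 : ℂ)
  have hZb : HasFDerivAt (wirtZbar g) _ z :=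
    ((hv 1).add ((hv I).const_mul I)).const_mul (1 / 2 : ℂ)
  have hsymm : fderiv ℝ (fderiv ℝ g) z 1 I = fderiv ℝ (fderiv ℝ g) z I 1 :=
    (hg.contDiffAt.isSymmSndFDerivAt
      (by simpa using WithTop.coe_le_coe.2 (le_top : (2 : ℕ∞) ≤ ⊤))).eq 1 I
  rw [wirtZbar, wirtZ, hZ.fderiv, hZb.fderiv]
  simp only [smul_apply, add_apply,
    sub_apply, ContinuousLinearMap.flip_apply, smul_eq_mul, hsymm]
  ring

section pairC

variable {m : ℕ}

lemma pairC_comm (u v : Fin m → ℂ) : pairC u v = pairC v u := by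
  simp only [pairC, mul_comm]

lemma pairC_sub_mul_self (u v : Fin m → ℂ) (c : ℂ) :
    pairC (fun i => u i - c * v i) (fun i => u i - c * v i) =
      pairC u u - 2 * c * pairC u v + c ^ 2 * pairC v v := by
  simp only [pairC, Finset.mul_sum, ← Finset.sum_sub_distrib, ← Finset.sum_add_distrib]
  exact Finset.sum_congr rfl fun i _ => by ring

lemma pairC_mul_add_mul (u v w : Fin m → ℂ) (a b : ℂ) :
    pairC u (fun i => a * v i + b * w i) = a * pairC u v + b * pairC u w := by
  simp only [pairC, Finset.mul_sum, ← Finset.sum_add_distrib]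
  exact Finset.sum_congr rfl fun i _ => by ring

lemma wirtZ_pairC {u v : ℂ → Fin m → ℂ} (hu : ∀ i, Differentiable ℝ fun w => u w i)
    (hv : ∀ i, Differentiable ℝ fun w => v w i) (z : ℂ) :
    wirtZ (fun w => pairC (u w) (v w)) z = pairC (WZ u z) (v z) + pairC (u z) (WZ v z) := by
  simp only [pairC, WZ, ← Finset.sum_add_distrib, ← wirtZ_mul (hu _) (hv _)]
  exact wirtZ_sum _ (fun i => (hu i).mul (hv i)) z

lemma wirtZbar_pairC {u v : ℂ → Fin m → ℂ} (hu : ∀ i, Differentiable ℝ fun w => u w i)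
    (hv : ∀ i, Differentiable ℝ fun w => v w i) (z : ℂ) :
    wirtZbar (fun w => pairC (u w) (v w)) z = pairC (WZb u z) (v z) + pairC (u z) (WZb v z) := by
  simp only [pairC, WZb, ← Finset.sum_add_distrib, ← wirtZbar_mul (hu _) (hv _)]
  exact wirtZbar_sum _ (fun i => (hu i).mul (hv i)) z

end pairC

/-- the Hopf differential coefficient `⟨Ω, Ω⟩` is holomorphic. -/
theorem hopf_coefficient_holomorphic (n : ℕ) (hn : 3 ≤ n)
    (f : ℂ → Fin (n + 1) → ℝ) (ρ : ℂ → ℝ) (hf : IsConfMinImm f ρ) :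
    ∀ z : ℂ, wirtZbar (fun w => pairC (Hopf f ρ w) (Hopf f ρ w)) z = 0 := by
  obtain ⟨hfs, hρs, hsphere, hconf, -, hmin⟩ := hf
  set F := Fc f
  have hF (i) : ContDiff ℝ ∞ fun w => F w i :=
    ofRealCLM.contDiff.comp (contDiff_pi.1 hfs i)
  have hF₁ (i) : ContDiff ℝ ∞ fun w => WZ F w i := contDiff_wirtZ (hF i)
  have hF₂ (i) : ContDiff ℝ ∞ fun w => WZ (WZ F) w i := contDiff_wirtZ (hF₁ i)
  have dF (i) : Differentiable ℝ fun w => F w i := (hF i).differentiable (by simp)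
  have dF₁ (i) : Differentiable ℝ fun w => WZ F w i := (hF₁ i).differentiable (by simp)
  have dF₂ (i) : Differentiable ℝ fun w => WZ (WZ F) w i := (hF₂ i).differentiable (by simp)
  have hFF (w) : pairC (F w) (F w) = 1 := by
    simp only [pairC, F, Fc, cV, ← sq]
    exact_mod_cast hsphere w
  have hF₁F (w) : pairC (WZ F w) (F w) = 0 := by
    have h := wirtZ_pairC dF dF w
    simp only [hFF, wirtZ_const, pairC_comm (F w)] at h
    linear_combination -h / 2
  have hF₂F (w) : pairC (WZ (WZ F) w) (F w) = 0 := by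
    have h := wirtZ_pairC dF₁ dF w
    simp only [hF₁F, wirtZ_const, hconf] at h
    linear_combination -h
  have hF₂F₁ (w) : pairC (WZ (WZ F) w) (WZ F w) = 0 := by
    have h := wirtZ_pairC dF₁ dF₁ w
    simp only [hconf, wirtZ_const, pairC_comm (WZ F w)] at h
    linear_combination -h / 2
  have hΩ (w) : pairC (Hopf f ρ w) (Hopf f ρ w) = pairC (WZ (WZ F) w) (WZ (WZ F) w) := by
    refine (pairC_sub_mul_self (WZ (WZ F) w) (WZ F w) (2 * dZ ρ w)).trans ?_
    rw [hF₂F₁, hconf]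
    ring
  intro z
  set a : ℂ → ℂ := fun w => -(1 / 2 : ℂ) * (Real.exp (2 * ρ w) : ℂ)
  have ha : Differentiable ℝ a := by
    have hexp : ContDiff ℝ ∞ fun w => Real.exp (2 * ρ w) := (contDiff_const.mul hρs).exp
    exact (contDiff_const.mul (ofRealCLM.contDiff.comp hexp)).differentiable (by simp)
  have hF₂zbar : WZb (WZ (WZ F)) z = fun i => wirtZ a z * F z i + a z * WZ F z i := by
    funext i
    calc wirtZbar (wirtZ fun w => WZ F w i) z
        = wirtZ (fun w => WZb (WZ F) w i) z := wirtZbar_wirtZ_comm (hF₁ i) z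
      _ = wirtZ (fun w => a w * F w i) z := by simp only [hmin, a]
      _ = _ := wirtZ_mul ha (dF i) z
  simp only [hΩ]
  rw [wirtZbar_pairC dF₂ dF₂, pairC_comm (WZb _ z), hF₂zbar, pairC_mul_add_mul, hF₂F, hF₂F₁]
  ring
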